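/- Let n ≥ 1 and let g be an invertible n×n real matrix all of whose complex eigenvalues are real and positive. Then there exists a real analytic map E : ℝ → M_n(ℝ) such that E(0) is the identity matrix, E(1) = g, and E(x + y) = E(x)·E(y) for all x, y ∈ ℝ (in particular E(m) = g^m for every integer m); moreover, every E(x) is invertible with all complex eigenvalues real and positive, and E can be chosen so that every n×n real matrix k with k·g = g·k also satisfies k·E(x) = E(x)·k for every x ∈ ℝ. -/

import Mathlib

/-- All complex eigenvalues of a real matrix are real and positive. -/
def EigsRealPos {n : ℕ} (A : Matrix (Fin n) (Fin n) ℝ) : Prop :=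
  ∀ z : ℂ, (Matrix.charpoly (A.map Complex.ofReal)).IsRoot z → z.im = 0 ∧ 0 < z.re

open NormedSpace in
/-- In a commutative real Banach algebra, the exponential reaches every element that is joined
to `1` by a segment of units. -/
theorem exists_exp_eq_of_isUnit_segment {A : Type*} [NormedRing A] [NormedAlgebra ℝ A]
    [CompleteSpace A] (hcomm : ∀ x y : A, Commute x y) (a : A)
    (h : ∀ t ∈ Set.Icc (0 : ℝ) 1, IsUnit (1 + t • (a - 1))) : ∃ b : A, exp b = a := by
  let _ : NormedAlgebra ℚ A := NormedAlgebra.restrictScalars ℚ ℝ A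
  let H : Subgroup Aˣ :=
    { carrier := {u | ∃ b : A, exp b = u}
      one_mem' := ⟨0, by simp⟩
      mul_mem' := by
        rintro u v ⟨b, hb⟩ ⟨c, hc⟩
        exact ⟨b + c, by rw [exp_add_of_commute (hcomm b c), hb, hc, Units.val_mul]⟩
      inv_mem' := by
        rintro u ⟨b, hb⟩
        exact ⟨-b, by rw [← Ring.inverse_exp, hb, Ring.inverse_unit]⟩ }
  have hnhds : (H : Set Aˣ) ∈ nhds 1 := by
    have hmap : Filter.map (exp : A → A) (nhds 0) = nhds (exp 0) :=
      HasStrictFDerivAt.map_nhds_eq_of_equiv (f' := ContinuousLinearEquiv.refl ℝ A)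
        (hasStrictFDerivAt_exp_zero (𝕂 := ℝ))
    have hrange : Set.range (exp : A → A) ∈ nhds ((1 : Aˣ) : A) := by
      rw [Units.val_one, ← exp_zero, ← hmap]
      exact Filter.range_mem_map
    exact Units.continuous_val.continuousAt.preimage_mem_nhds hrange
  have hopen : IsOpen (H : Set Aˣ) := H.isOpen_of_mem_nhds hnhds
  have hclopen : IsClopen (H : Set Aˣ) := ⟨H.isClosed_of_isOpen hopen, hopen⟩
  let γ : Set.Icc (0 : ℝ) 1 → Aˣ := fun t => (h t t.2).unit
  have hγ : Continuous γ := by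
    rw [Units.isOpenEmbedding_val.isInducing.continuous_iff]
    change Continuous fun t : Set.Icc (0 : ℝ) 1 => 1 + (t : ℝ) • (a - 1)
    fun_prop
  have hpre : IsPreconnected (Set.range γ) := isPreconnected_range hγ
  have hone : γ 0 = 1 := Units.ext (by simp [γ])
  have hmem : γ 1 ∈ (H : Set Aˣ) :=
    hpre.subset_isClopen hclopen ⟨γ 0, ⟨0, rfl⟩, by rw [hone]; exact H.one_mem⟩ ⟨1, rfl⟩
  obtain ⟨b, hb⟩ := hmem
  exact ⟨b, by simpa [γ] using hb⟩

/-- An element of a finite-dimensional subalgebra that is invertible in the ambient algebra is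
invertible in the subalgebra. -/
theorem Subalgebra.isUnit_of_isUnit_coe {K B : Type*} [Field K] [Ring B] [Algebra K B]
    (S : Subalgebra K B) [FiniteDimensional K S] {s : S} (hs : IsUnit (s : B)) : IsUnit s :=
  IsArtinianRing.isUnit_of_nonZeroDivisor_of_isIntegral' (R := K)
    (comap_nonZeroDivisors_le_of_injective (f := S.val) Subtype.val_injective
      hs.mem_nonZeroDivisors)

/-- In a finite-dimensional real Banach algebra, an element joined to `1` by a segment of units lies
on an analytic one-parameter group inside the subalgebra it generates. -/
theorem exists_analytic_oneParameterGroup {B : Type*} [NormedRing B] [NormedAlgebra ℝ B]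
    [FiniteDimensional ℝ B] (g : B)
    (h : ∀ t ∈ Set.Icc (0 : ℝ) 1, IsUnit (1 + t • (g - 1))) :
    ∃ E : ℝ → B, (∀ x, AnalyticAt ℝ E x) ∧ E 0 = 1 ∧ E 1 = g ∧
      (∀ x y, E (x + y) = E x * E y) ∧ ∀ x, E x ∈ Algebra.adjoin ℝ {g} := by
  let S := Algebra.adjoin ℝ {g}
  let _ : NormedAlgebra ℚ S := NormedAlgebra.restrictScalars ℚ ℝ S
  have hfin : FiniteDimensional ℝ S := FiniteDimensional.finiteDimensional_subalgebra S
  have hcomplete : CompleteSpace S := FiniteDimensional.complete ℝ S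
  have hcomm : ∀ x y : S, Commute x y := fun x y => by
    have := Algebra.isMulCommutative_adjoin ℝ (s := {g}) (by simp)
    exact mul_comm' x y
  obtain ⟨b, hb⟩ := exists_exp_eq_of_isUnit_segment hcomm
    ⟨g, Algebra.self_mem_adjoin_singleton ℝ g⟩ fun t ht => S.isUnit_of_isUnit_coe (h t ht)
  refine ⟨fun x => (NormedSpace.exp (x • b) : S), fun x => ?_, by simp, by simp [hb],
    fun x y => ?_, fun x => (NormedSpace.exp (x • b) : S).2⟩
  · have hexp : AnalyticAt ℝ (fun x : ℝ => NormedSpace.exp (x • b)) x :=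
      (NormedSpace.exp_analytic (𝕂 := ℝ) (x • b)).comp_of_eq
        (analyticAt_id.smul analyticAt_const) rfl
    exact (S.val.toLinearMap.toContinuousLinearMap.analyticAt _).comp hexp
  · simp only [add_smul, NormedSpace.exp_add_of_commute (hcomm (x • b) (y • b)),
      MulMemClass.coe_mul]

theorem EigsRealPos.isUnit_segment {n : ℕ} {g : Matrix (Fin n) (Fin n) ℝ} (heig : EigsRealPos g)
    {t : ℝ} (ht : t ∈ Set.Icc (0 : ℝ) 1) : IsUnit (1 + t • (g - 1)) := by
  rcases ht.1.eq_or_lt with rfl | htpos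
  · simp
  set c : ℝ := -((1 - t) / t)
  have hc : c ∉ spectrum ℝ g := by
    rw [Matrix.mem_spectrum_iff_isRoot_charpoly]
    intro hroot
    have hroot' : (Matrix.charpoly (g.map Complex.ofReal)).IsRoot (c : ℂ) := by
      have := hroot.map (f := Complex.ofRealHom)
      rwa [← Matrix.charpoly_map] at this
    have hcpos : 0 < c := by simpa using (heig _ hroot').2
    have : 0 ≤ (1 - t) / t := div_nonneg (sub_nonneg.2 ht.2) ht.1
    linarith
  have hunit := spectrum.notMem_iff.1 hc
  have hfactor : 1 + t • (g - 1) = (-t) • (algebraMap ℝ (Matrix (Fin n) (Fin n) ℝ) c - g) := by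
    rw [Algebra.algebraMap_eq_smul_one, smul_sub (-t), smul_smul,
      show -t * c = 1 - t by simp only [c]; field_simp]
    module
  rw [hfactor]
  exact hunit.smul (Units.mk0 (-t) (neg_ne_zero.2 htpos.ne'))

/-- The square of an invertible real polynomial in a matrix with real spectrum has positive
spectrum. -/
theorem EigsRealPos.sq_of_mem_adjoin {n : ℕ} (hn : 1 ≤ n) {g h : Matrix (Fin n) (Fin n) ℝ}
    (heig : EigsRealPos g) (hh : h ∈ Algebra.adjoin ℝ {g}) (hu : IsUnit h) :
    EigsRealPos (h * h) := by
  have : Nonempty (Fin n) := ⟨⟨0, hn⟩⟩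
  rw [Algebra.adjoin_singleton_eq_range_aeval] at hh
  obtain ⟨p, rfl⟩ := hh
  let φ : Matrix (Fin n) (Fin n) ℝ →ₐ[ℝ] Matrix (Fin n) (Fin n) ℂ := Complex.ofRealAm.mapMatrix
  have hmap : φ (Polynomial.aeval g p) =
      Polynomial.aeval (φ g) (p.map (algebraMap ℝ ℂ)) := by
    rw [Polynomial.aeval_map_algebraMap, Polynomial.aeval_algHom_apply]
  intro z hz
  rw [← Matrix.mem_spectrum_iff_isRoot_charpoly] at hz
  change z ∈ spectrum ℂ (φ (Polynomial.aeval g p * Polynomial.aeval g p)) at hz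
  rw [map_mul, ← sq, spectrum.map_pow_of_pos _ two_pos] at hz
  obtain ⟨w, hw, rfl⟩ := hz
  have hw0 : w ≠ 0 := spectrum.ne_zero_of_mem_of_unit (a := (hu.map φ).unit) hw
  rw [hmap, spectrum.map_polynomial_aeval_of_nonempty _ _
    (spectrum.nonempty_of_isAlgClosed_of_finiteDimensional ℂ _)] at hw
  obtain ⟨l, hl, rfl⟩ := hw
  rw [Matrix.mem_spectrum_iff_isRoot_charpoly] at hl
  obtain ⟨r, rfl⟩ : ∃ r : ℝ, (r : ℂ) = l := ⟨l.re, Complex.ext rfl (heig l hl).1.symm⟩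
  have heval : Polynomial.eval (r : ℂ) (p.map (algebraMap ℝ ℂ)) = ((p.eval r : ℝ) : ℂ) :=
    Polynomial.eval_map_apply (algebraMap ℝ ℂ) r
  simp only [heval, ← Complex.ofReal_pow, Complex.ofReal_im, Complex.ofReal_re] at hw0 ⊢
  exact ⟨trivial, sq_pos_of_ne_zero (by exact_mod_cast hw0)⟩

/-- Every invertible `n × n` real matrix `g` with all complex eigenvalues
real and positive embeds in a real analytic one-parameter group `E : ℝ → Mₙ(ℝ)` with
`E 0 = 1`, `E 1 = g`, `E (x + y) = E x * E y` (so `E m = g ^ m` on integers); moreover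
each `E x` is invertible with all eigenvalues real and positive, and `E` may be chosen so
that every matrix commuting with `g` commutes with every `E x`. -/
theorem real_matrix_exponentiation
    (n : ℕ) (hn : 1 ≤ n) (g : Matrix (Fin n) (Fin n) ℝ)
    (hg : IsUnit g) (heig : EigsRealPos g) :
    ∃ E : ℝ → Matrix (Fin n) (Fin n) ℝ,
      (∀ i j, AnalyticOnNhd ℝ (fun x => E x i j) Set.univ) ∧
      E 0 = 1 ∧ E 1 = g ∧
      (∀ x y : ℝ, E (x + y) = E x * E y) ∧
      (∀ m : ℕ, E (m : ℝ) = g ^ m) ∧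
      (∀ m : ℕ, E (-(m : ℝ)) * g ^ m = 1) ∧
      (∀ x : ℝ, IsUnit (E x) ∧ EigsRealPos (E x)) ∧
      (∀ k : Matrix (Fin n) (Fin n) ℝ, k * g = g * k → ∀ x : ℝ, k * E x = E x * k) := by
  let _ : NormedRing (Matrix (Fin n) (Fin n) ℝ) := Matrix.linftyOpNormedRing
  let _ : NormedAlgebra ℝ (Matrix (Fin n) (Fin n) ℝ) := Matrix.linftyOpNormedAlgebra
  obtain ⟨E, hanalytic, hzero, hone, hadd, hmem⟩ :=
    exists_analytic_oneParameterGroup g fun _ ht => heig.isUnit_segment ht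
  have hnat : ∀ m : ℕ, E (m : ℝ) = g ^ m := fun m => by
    induction m with
    | zero => simpa using hzero
    | succ m ih => rw [Nat.cast_succ, hadd, ih, hone, pow_succ]
  have hunit : ∀ x : ℝ, IsUnit (E x) := fun x =>
    IsUnit.of_mul_eq_one (E (-x)) (by rw [← hadd, add_neg_cancel, hzero])
  refine ⟨E, fun i j x _ => ?_, hzero, hone, hadd, hnat, fun m => ?_, fun x => ⟨hunit x, ?_⟩,
    fun k hk x => Algebra.commute_of_mem_adjoin_singleton_of_commute (hmem x) hk⟩
  · exact ((Matrix.entryLinearMap ℝ ℝ i j).toContinuousLinearMap.analyticAt _).comp (hanalytic x)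
  · rw [← hnat, ← hadd, neg_add_cancel, hzero]
  · rw [← add_halves x, hadd]
    exact heig.sq_of_mem_adjoin hn (hmem _) (hunit _)
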